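/- arXiv:2411.08110 — 2 statements merged into one kernel-verified Lean document; each statement's English description precedes it below -/
import Mathlib

section
/- For the uniform ensemble of the d² clock-shift unitary channels ρ ↦ (X_d^i Z_d^j) ρ (X_d^i Z_d^j)† on ℂ^d, every memory-(1,1) two-copy adaptive tester without additional classical memory {T^{(i,j)}}_{i,j=0}^{d−1} has success probability (1/d²)∑_{i,j} Tr(T^{(i,j)} (C^{(i,j)} ⊗ C^{(i,j)})) ≤ 1/d, where C^{(i,j)} is the Choi matrix of the unitary X_d^i Z_d^j. -/
open Matrix BigOperators ComplexOrder

noncomputable section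

/-- A quantum state on a finite-dimensional system: a positive semidefinite matrix of trace one. -/
def IsState {n : Type*} [Fintype n] (ρ : Matrix n n ℂ) : Prop :=
  ρ.PosSemidef ∧ ρ.trace = 1

/-- A POVM: a finite family of positive semidefinite matrices summing to the identity. -/
def IsPOVM {n ι : Type*} [Fintype n] [DecidableEq n] [Fintype ι]
    (M : ι → Matrix n n ℂ) : Prop :=
  (∀ i, (M i).PosSemidef) ∧ ∑ i, M i = (1 : Matrix n n ℂ)

/-- The primitive `d`-th root of unity `ω = e^{2πi/d}`. -/
def omega (d : ℕ) : ℂ := Complex.exp (2 * (Real.pi : ℂ) * Complex.I / d)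

/-- The clock operator `X_d = ∑_l |l⊕1⟩⟨l|`. -/
def clockX (d : ℕ) [NeZero d] : Matrix (Fin d) (Fin d) ℂ :=
  Matrix.of fun k l => if k = l + 1 then 1 else 0

/-- The shift operator `Z_d = ∑_l ω^l |l⟩⟨l|`. -/
def clockZ (d : ℕ) : Matrix (Fin d) (Fin d) ℂ :=
  Matrix.diagonal fun l => omega d ^ (l : ℕ)

/-- The clock-shift unitary `X_d^i Z_d^j`. -/
def clockShift (d : ℕ) [NeZero d] (i j : Fin d) : Matrix (Fin d) (Fin d) ℂ :=
  clockX d ^ (i : ℕ) * clockZ d ^ (j : ℕ)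

/-- The Choi matrix `|U⟩⟩⟨⟨U|` of the unitary channel of `U`, with `|U⟩⟩ = ∑_l |l⟩ ⊗ U|l⟩`. -/
def choiU {d : ℕ} (U : Matrix (Fin d) (Fin d) ℂ) :
    Matrix (Fin d × Fin d) (Fin d × Fin d) ℂ :=
  Matrix.of fun p q => U p.2 p.1 * starRingEnd ℂ (U q.2 q.1)

/-- `C ⊗ C` on the system `I₁ ⊗ O₁ ⊗ I₂ ⊗ O₂` (two copies of an `I → O` Choi matrix). -/
def choiPair {d : ℕ} (C : Matrix (Fin d × Fin d) (Fin d × Fin d) ℂ) :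
    Matrix (Fin d × Fin d × Fin d × Fin d) (Fin d × Fin d × Fin d × Fin d) ℂ :=
  Matrix.of fun p q =>
    C (p.1, p.2.1) (q.1, q.2.1) * C (p.2.2.1, p.2.2.2) (q.2.2.1, q.2.2.2)

/-- A memory-(1,1) two-copy adaptive tester element without additional classical memory:
`T = ρ_{I₁} ⊗ K_{O₁I₂} ⊗ (M_{O₂})ᵀ`, ordered on `I₁ ⊗ O₁ ⊗ I₂ ⊗ O₂`. -/
def memFreeAdaptT {d : ℕ} (ρ : Matrix (Fin d) (Fin d) ℂ)
    (K : Matrix (Fin d × Fin d) (Fin d × Fin d) ℂ)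
    (M : Matrix (Fin d) (Fin d) ℂ) :
    Matrix (Fin d × Fin d × Fin d × Fin d) (Fin d × Fin d × Fin d × Fin d) ℂ :=
  Matrix.of fun p q =>
    ρ p.1 q.1 * K (p.2.1, p.2.2.1) (q.2.1, q.2.2.1) * M q.2.2.2 p.2.2.2

lemma clockX_mem_unitaryGroup (d : ℕ) [NeZero d] : clockX d ∈ unitaryGroup (Fin d) ℂ := by
  rw [mem_unitaryGroup_iff']
  ext i j
  simp [clockX, Matrix.mul_apply, star_apply, Matrix.one_apply, apply_ite, eq_comm]

lemma clockZ_mem_unitaryGroup (d : ℕ) : clockZ d ∈ unitaryGroup (Fin d) ℂ := by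
  have h : star (omega d) * omega d = 1 := by
    have h' : ‖omega d‖ = 1 := by
      have : 2 * (Real.pi : ℂ) * Complex.I / d = ((2 * Real.pi / d : ℝ) : ℂ) * Complex.I := by
        push_cast
        ring
      rw [omega, this, Complex.norm_exp_ofReal_mul_I]
    rw [Complex.star_def, Complex.conj_mul', h']
    norm_num
  rw [mem_unitaryGroup_iff', clockZ, star_eq_conjTranspose, diagonal_conjTranspose,
    diagonal_mul_diagonal, ← diagonal_one]
  congr 1
  ext i
  rw [Pi.star_apply, star_pow, ← mul_pow, h, one_pow]

lemma clockShift_mem_unitaryGroup (d : ℕ) [NeZero d] (i j : Fin d) :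
    clockShift d i j ∈ unitaryGroup (Fin d) ℂ :=
  mul_mem (pow_mem (clockX_mem_unitaryGroup d) _) (pow_mem (clockZ_mem_unitaryGroup d) _)

section Frobenius

open scoped MatrixOrder

attribute [local instance] Matrix.frobeniusNormedAddCommGroup

lemma re_trace_conjTranspose_mul_self {m n : Type*} [Fintype m] [Fintype n]
    (A : Matrix m n ℂ) : (Aᴴ * A).trace.re = ‖A‖ ^ 2 := by
  rw [frobenius_norm_def, ← Real.rpow_natCast, ← Real.rpow_mul (by positivity)]
  norm_num [Matrix.trace, Matrix.mul_apply, ← Complex.normSq_eq_norm_sq, Complex.normSq_apply]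
  exact Finset.sum_comm

/-- The trace of a product of positive semidefinite matrices is at most the product of the
traces. -/
lemma re_trace_mul_le {n : Type*} [Fintype n] [DecidableEq n] {A B : Matrix n n ℂ}
    (hA : A.PosSemidef) (hB : B.PosSemidef) :
    (A * B).trace.re ≤ A.trace.re * B.trace.re := by
  obtain ⟨X, rfl⟩ := CStarAlgebra.nonneg_iff_eq_star_mul_self.mp hA.nonneg
  obtain ⟨Y, rfl⟩ := CStarAlgebra.nonneg_iff_eq_star_mul_self.mp hB.nonneg
  simp only [star_eq_conjTranspose]
  have h : (Xᴴ * X * (Yᴴ * Y)).trace = ((X * Yᴴ)ᴴ * (X * Yᴴ)).trace := by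
    rw [conjTranspose_mul, conjTranspose_conjTranspose, Matrix.mul_assoc Y,
      Matrix.trace_mul_comm Y]
    simp only [Matrix.mul_assoc]
  rw [h, re_trace_conjTranspose_mul_self, re_trace_conjTranspose_mul_self,
    re_trace_conjTranspose_mul_self, ← mul_pow, ← frobenius_norm_conjTranspose Y]
  gcongr
  exact frobenius_norm_mul _ _

end Frobenius

/-- The amplitude with which `U`, used twice, maps `a` to `b` and `c` to `e`. -/
def twoUseAmplitude {d : ℕ} (U : Matrix (Fin d) (Fin d) ℂ) :
    Matrix (Fin d × Fin d × Fin d) (Fin d) ℂ :=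
  Matrix.of fun x e => U x.2.1 x.1 * U e x.2.2

/-- The (transposed) state on `O₂` obtained by applying `U`, then `K`, then `U` to `ρ`. -/
def adaptiveOutput {d : ℕ} (ρ : Matrix (Fin d) (Fin d) ℂ)
    (K : Matrix (Fin d × Fin d) (Fin d × Fin d) ℂ) (U : Matrix (Fin d) (Fin d) ℂ) :
    Matrix (Fin d) (Fin d) ℂ :=
  (twoUseAmplitude U)ᴴ * kroneckerMap (· * ·) ρ K * twoUseAmplitude U

lemma posSemidef_adaptiveOutput {d : ℕ} {ρ : Matrix (Fin d) (Fin d) ℂ}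
    {K : Matrix (Fin d × Fin d) (Fin d × Fin d) ℂ} (hρ : ρ.PosSemidef) (hK : K.PosSemidef)
    (U : Matrix (Fin d) (Fin d) ℂ) : (adaptiveOutput ρ K U).PosSemidef :=
  (hρ.kronecker hK).conjTranspose_mul_mul_same _

lemma sum_mul_star_of_mem_unitaryGroup {n : Type*} [Fintype n] [DecidableEq n]
    {U : Matrix n n ℂ} (hU : U ∈ unitaryGroup n ℂ) (c c' : n) :
    ∑ e, U e c' * star (U e c) = if c = c' then 1 else 0 := by
  have h := congrFun (congrFun (mem_unitaryGroup_iff'.mp hU) c) c'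
  simpa [Matrix.mul_apply, star_apply, Matrix.one_apply, mul_comm] using h

lemma trace_adaptiveOutput {d : ℕ} {ρ : Matrix (Fin d) (Fin d) ℂ}
    {K : Matrix (Fin d × Fin d) (Fin d × Fin d) ℂ}
    (hK : ∀ o o' : Fin d, (∑ x : Fin d, K (o, x) (o', x)) = if o = o' then 1 else 0)
    {U : Matrix (Fin d) (Fin d) ℂ} (hU : U ∈ unitaryGroup (Fin d) ℂ) :
    (adaptiveOutput ρ K U).trace = ρ.trace := by
  have hW (x y : Fin d × Fin d × Fin d) :
      (twoUseAmplitude U * (twoUseAmplitude U)ᴴ) y x =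
        U y.2.1 y.1 * star (U x.2.1 x.1) * if x.2.2 = y.2.2 then 1 else 0 := by
    rw [← sum_mul_star_of_mem_unitaryGroup hU, Finset.mul_sum, Matrix.mul_apply]
    refine Finset.sum_congr rfl fun e _ => ?_
    simp only [twoUseAmplitude, Matrix.of_apply, conjTranspose_apply, star_mul']
    ring
  rw [adaptiveOutput, Matrix.mul_assoc, Matrix.trace_mul_comm, Matrix.mul_assoc]
  calc _ = ∑ a, ∑ b, ∑ a', ∑ b', ρ a a' * (U b' a' * star (U b a)) * ∑ c, K (b, c) (b', c) := by
        simp only [Matrix.trace, Matrix.diag_apply, Matrix.mul_apply (M := kroneckerMap (· * ·) ρ K), hW,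
          Fintype.sum_prod_type, kroneckerMap_apply, mul_ite, mul_one, mul_zero,
          Finset.sum_ite_eq, Finset.mem_univ, if_true, Finset.mul_sum]
        refine Finset.sum_congr rfl fun a _ => Finset.sum_congr rfl fun b _ => ?_
        rw [Finset.sum_comm]
        refine Finset.sum_congr rfl fun a' _ => ?_
        rw [Finset.sum_comm]
        refine Finset.sum_congr rfl fun b' _ => Finset.sum_congr rfl fun c _ => ?_
        ring
    _ = ∑ a, ∑ a', ρ a a' * ∑ b, U b a' * star (U b a) := by
        simp only [hK, mul_ite, mul_one, mul_zero, Finset.sum_ite_eq, Finset.mem_univ, if_true,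
          Finset.mul_sum]
        exact Finset.sum_congr rfl fun a _ => Finset.sum_comm
    _ = ρ.trace := by
        simp only [sum_mul_star_of_mem_unitaryGroup hU, mul_ite, mul_one, mul_zero,
          Finset.sum_ite_eq, Finset.mem_univ, if_true, Matrix.trace, Matrix.diag_apply]

lemma trace_memFreeAdaptT_mul_choiPair {d : ℕ} (ρ : Matrix (Fin d) (Fin d) ℂ)
    (K : Matrix (Fin d × Fin d) (Fin d × Fin d) ℂ) (M U : Matrix (Fin d) (Fin d) ℂ) :
    (memFreeAdaptT ρ K M * choiPair (choiU U)).trace = (M * adaptiveOutput ρ K U).trace := by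
  let e₁ : (Fin d × Fin d × Fin d) × Fin d ≃ Fin d × Fin d × Fin d × Fin d :=
    (Equiv.prodAssoc _ _ _).trans ((Equiv.refl _).prodCongr (Equiv.prodAssoc _ _ _))
  rw [Matrix.trace_mul_comm M]
  simp only [Matrix.trace, Matrix.diag_apply, Matrix.mul_apply, adaptiveOutput, Finset.sum_mul]
  simp_rw [← e₁.sum_comp]
  simp only [Fintype.sum_prod_type (α₁ := Fin d × Fin d × Fin d)]
  rw [Finset.sum_comm]
  refine Finset.sum_congr rfl fun e _ => ?_
  simp_rw [Finset.sum_comm (s := (Finset.univ : Finset (Fin d × Fin d × Fin d)))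
    (t := (Finset.univ : Finset (Fin d)))]
  refine Finset.sum_congr rfl fun e' _ => ?_
  rw [Finset.sum_comm]
  refine Finset.sum_congr rfl fun y _ => Finset.sum_congr rfl fun x _ => ?_
  simp only [memFreeAdaptT, choiPair, choiU, twoUseAmplitude, Matrix.of_apply,
    kroneckerMap_apply, conjTranspose_apply, star_mul', e₁, Equiv.trans_apply,
    Equiv.prodCongr_apply, Equiv.prodAssoc_apply, Equiv.refl_apply, Prod.map, starRingEnd_apply]
  ring

/-- For the uniform ensemble of the `d²` clock-shift unitary channels, every
memory-(1,1) two-copy adaptive tester without additional classical memory has success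
probability at most `1/d`. -/
theorem clock_shift_memoryless_adaptive_bound (d : ℕ) [NeZero d]
    (ρ : Matrix (Fin d) (Fin d) ℂ) (hρ : IsState ρ)
    (K : Matrix (Fin d × Fin d) (Fin d × Fin d) ℂ) (hK : K.PosSemidef)
    (hKtr : ∀ o o' : Fin d, (∑ x : Fin d, K (o, x) (o', x)) = if o = o' then 1 else 0)
    (M : Fin d × Fin d → Matrix (Fin d) (Fin d) ℂ) (hM : IsPOVM M) :
    (1 / (d : ℝ) ^ 2) * (∑ ij : Fin d × Fin d,
        Matrix.trace (memFreeAdaptT ρ K (M ij) *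
          choiPair (choiU (clockShift d ij.1 ij.2)))).re ≤ 1 / d := by
  have hbound (ij : Fin d × Fin d) :
      (memFreeAdaptT ρ K (M ij) * choiPair (choiU (clockShift d ij.1 ij.2))).trace.re ≤
        (M ij).trace.re := by
    have h := re_trace_mul_le (hM.1 ij)
      (posSemidef_adaptiveOutput hρ.1 hK (clockShift d ij.1 ij.2))
    rwa [trace_adaptiveOutput hKtr (clockShift_mem_unitaryGroup d _ _), hρ.2, Complex.one_re,
      mul_one, ← trace_memFreeAdaptT_mul_choiPair] at h
  have htrace : ∑ ij, (M ij).trace.re = d := by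
    rw [← Complex.re_sum, ← Matrix.trace_sum, hM.2]
    simp
  have hd : (d : ℝ) ≠ 0 := Nat.cast_ne_zero.mpr (NeZero.ne d)
  calc _ ≤ 1 / (d : ℝ) ^ 2 * d := by
        rw [Complex.re_sum, ← htrace]
        exact mul_le_mul_of_nonneg_left (Finset.sum_le_sum fun ij _ => hbound ij) (by positivity)
    _ = 1 / d := by
        field_simp
end
end

section
/- For every d ≥ 1, the d² clock-shift unitary channels on ℂ^d can be perfectly discriminated with two uses, no quantum memory, and classical memory: there exist a state ρ on ℂ^d, a d-outcome POVM {F^k}_{k=0}^{d−1} on ℂ^d, states {σ^k}_{k=0}^{d−1} on ℂ^d, and d²-outcome POVMs {M^{(a,b)|k}}_{a,b} on ℂ^d for each k, such that the two-copy classically adaptive tester T^{(a,b)} := ∑_{k=0}^{d−1} ρ ⊗ (F^k)^T ⊗ σ^k ⊗ (M^{(a,b)|k})^T (ordered on I₁O₁I₂O₂) satisfies (1/d²)∑_{a,b=0}^{d−1} Tr(T^{(a,b)} (C^{(a,b)} ⊗ C^{(a,b)})) = 1, where C^{(a,b)} is the Choi matrix of the unitary X_d^a Z_d^b. Concretely,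 one may take ρ = |0⟩⟨0|, F^k = |k⟩⟨k|, σ^k = |ψ_0⟩⟨ψ_0| and M^{(a,b)|k} = δ_{a,k} |ψ_b⟩⟨ψ_b|, where |ψ_j⟩ := (1/√d)∑_{l=0}^{d−1} ω^{jl}|l⟩ with ω = e^{2πi/d}. -/
open Matrix BigOperators ComplexOrder

noncomputable section

/-- A two-copy classically adaptive tester element without quantum memory:
`T^{(a,b)} = ∑_k ρ ⊗ (F^k)ᵀ ⊗ σ^k ⊗ (M^{(a,b)|k})ᵀ`, ordered on `I₁ ⊗ O₁ ⊗ I₂ ⊗ O₂`. -/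
def classMemT {d : ℕ} (ρ : Matrix (Fin d) (Fin d) ℂ)
    (F : Fin d → Matrix (Fin d) (Fin d) ℂ)
    (σs : Fin d → Matrix (Fin d) (Fin d) ℂ)
    (M : Fin d → Fin d × Fin d → Matrix (Fin d) (Fin d) ℂ)
    (ab : Fin d × Fin d) :
    Matrix (Fin d × Fin d × Fin d × Fin d) (Fin d × Fin d × Fin d × Fin d) ℂ :=
  Matrix.of fun p q =>
    ∑ k : Fin d,
      ρ p.1 q.1 * F k q.2.1 p.2.1 * σs k p.2.2.1 q.2.2.1 * M k ab q.2.2.2 p.2.2.2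

/-- The matrix entries of `X_d ^ n`. -/
lemma clockX_pow_apply (d : ℕ) [NeZero d] (n : ℕ) (k l : Fin d) :
    (clockX d ^ n) k l = if k = l + Fin.ofNat d n then 1 else 0 := by
  induction n generalizing k l with
  | zero => simp [Matrix.one_apply]
  | succ n ih =>
    have h : l + Fin.ofNat d (n + 1) = l + 1 + Fin.ofNat d n := by
      have : Fin.ofNat d (n + 1) = Fin.ofNat d n + 1 := by
        simp [Fin.ext_iff, Fin.val_add]
      rw [this, add_assoc, add_comm 1]
    rw [pow_succ, Matrix.mul_apply, h]
    simp only [ih]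
    simp [clockX]

/-- The matrix entries of `X_d ^ a * Z_d ^ b`. -/
lemma clockShift_apply (d : ℕ) [NeZero d] (a b k l : Fin d) :
    clockShift d a b k l = if k = l + a then omega d ^ ((l : ℕ) * (b : ℕ)) else 0 := by
  simp [clockShift, clockZ, Matrix.diagonal_pow, clockX_pow_apply, pow_mul]

lemma omega_isPrimitiveRoot (d : ℕ) [NeZero d] : IsPrimitiveRoot (omega d) d :=
  Complex.isPrimitiveRoot_exp d (NeZero.ne d)

lemma omega_mul_star (d : ℕ) [NeZero d] : omega d * star (omega d) = 1 := by
  have h : ‖omega d‖ = 1 := (omega_isPrimitiveRoot d).norm'_eq_one (NeZero.ne d)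
  rw [Complex.star_def, Complex.mul_conj, Complex.normSq_eq_norm_sq, h]
  simp

/-- Orthogonality of the characters `b ↦ ω ^ (n b)` of `ℤ / d`. -/
lemma sum_omega_pow_mul_star (d : ℕ) [NeZero d] (n m : Fin d) :
    ∑ b : Fin d, star (omega d ^ ((n : ℕ) * (b : ℕ))) * omega d ^ ((m : ℕ) * (b : ℕ)) =
      if n = m then (d : ℂ) else 0 := by
  set z : ℂ := star (omega d ^ (n : ℕ)) * omega d ^ (m : ℕ) with hz
  have hn : omega d ^ (n : ℕ) * star (omega d ^ (n : ℕ)) = 1 := by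
    rw [star_pow, ← mul_pow, omega_mul_star, one_pow]
  have hsum : ∑ b : Fin d, star (omega d ^ ((n : ℕ) * (b : ℕ))) *
      omega d ^ ((m : ℕ) * (b : ℕ)) = ∑ b ∈ Finset.range d, z ^ b := by
    rw [← Fin.sum_univ_eq_sum_range]
    simp [hz, pow_mul, mul_pow]
  rw [hsum]
  split_ifs with h
  · subst h
    have : z = 1 := by rw [hz, mul_comm, hn]
    simp [this]
  · have hz1 : z ≠ 1 := by
      intro h1
      refine h (Fin.ext ((omega_isPrimitiveRoot d).pow_inj n.2 m.2 ?_))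
      calc omega d ^ (n : ℕ) = omega d ^ (n : ℕ) * z := by rw [h1, mul_one]
        _ = omega d ^ (m : ℕ) := by rw [hz, ← mul_assoc, hn, one_mul]
    have hzd : z ^ d = 1 := by
      rw [hz, mul_pow, ← star_pow, pow_right_comm, pow_right_comm _ (m : ℕ),
        (omega_isPrimitiveRoot d).pow_eq_one]
      simp
    rw [geom_sum_eq hz1, hzd]
    simp

/-- The success weight of a classically adaptive tester factorizes, for each value of the classical
memory, into the outcome probabilities of the two uses. -/
lemma trace_classMemT_mul_choiPair {d : ℕ} (ρ : Matrix (Fin d) (Fin d) ℂ)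
    (F σs : Fin d → Matrix (Fin d) (Fin d) ℂ)
    (M : Fin d → Fin d × Fin d → Matrix (Fin d) (Fin d) ℂ) (ab : Fin d × Fin d)
    (U : Matrix (Fin d) (Fin d) ℂ) :
    Matrix.trace (classMemT ρ F σs M ab * choiPair (choiU U)) =
      ∑ k, Matrix.trace (F k * (U.map star * ρ * (U.map star)ᴴ)) *
        Matrix.trace (M k ab * (U.map star * σs k * (U.map star)ᴴ)) := by
  have born (A B : Matrix (Fin d) (Fin d) ℂ) :
      Matrix.trace (B * (U.map star * A * (U.map star)ᴴ)) =
        ∑ r : Fin d × Fin d, ∑ s : Fin d × Fin d,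
          A r.1 s.1 * B s.2 r.2 * choiU U s r := by
    simp only [Matrix.trace, Matrix.diag_apply, Matrix.mul_apply, Matrix.map_apply,
      Matrix.conjTranspose_apply, star_star, Finset.mul_sum, Finset.sum_mul,
      Fintype.sum_prod_type, choiU, Matrix.of_apply]
    calc _ = ∑ y', ∑ y, ∑ x', ∑ x, A x x' * B y' y * (U y' x' * star (U y x)) := by
          simp only [mul_comm, mul_left_comm, mul_assoc]
      _ = ∑ y, ∑ y', ∑ x, ∑ x', A x x' * B y' y * (U y' x' * star (U y x)) := by
          rw [Finset.sum_comm]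
          exact Finset.sum_congr rfl fun _ _ => Finset.sum_congr rfl fun _ _ => Finset.sum_comm
      _ = ∑ y, ∑ x, ∑ y', ∑ x', A x x' * B y' y * (U y' x' * star (U y x)) :=
          Finset.sum_congr rfl fun _ _ => Finset.sum_comm
      _ = ∑ x, ∑ y, ∑ x', ∑ y', A x x' * B y' y * (U y' x' * star (U y x)) := by
          rw [Finset.sum_comm]
          exact Finset.sum_congr rfl fun _ _ => Finset.sum_congr rfl fun _ _ => Finset.sum_comm
  have assoc (H : Fin d × Fin d × Fin d × Fin d → ℂ) :
      ∑ p, H p = ∑ r : Fin d × Fin d, ∑ s : Fin d × Fin d, H (r.1, r.2, s) := by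
    rw [← (Equiv.prodAssoc (Fin d) (Fin d) (Fin d × Fin d)).sum_comp, Fintype.sum_prod_type]
    rfl
  simp only [born, Finset.sum_mul_sum]
  simp only [Matrix.trace, Matrix.diag_apply, Matrix.mul_apply, assoc, classMemT, choiPair,
    Matrix.of_apply, Finset.sum_mul]
  simp only [Finset.sum_comm (s := (Finset.univ : Finset (Fin d × Fin d)))
    (t := (Finset.univ : Finset (Fin d)))]
  refine Finset.sum_congr rfl fun k _ => Finset.sum_congr rfl fun r _ =>
    Finset.sum_congr rfl fun r' _ => Finset.sum_congr rfl fun s _ =>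
    Finset.sum_congr rfl fun s' _ => ?_
  ring

lemma trace_vecMulVec_star_mul {d : ℕ} (A : Matrix (Fin d) (Fin d) ℂ) (v w : Fin d → ℂ) :
    Matrix.trace (vecMulVec v (star v) * (A * vecMulVec w (star w) * Aᴴ)) =
      (star v ⬝ᵥ (A *ᵥ w)) * (star (A *ᵥ w) ⬝ᵥ v) := by
  rw [mul_vecMulVec, vecMulVec_mul _ (star w), ← star_mulVec, vecMulVec_mul_vecMulVec, trace_vecMulVec,
    dotProduct_smul, smul_eq_mul, dotProduct_comm v]

lemma isState_vecMulVec_star {d : ℕ} {v : Fin d → ℂ} (hv : star v ⬝ᵥ v = 1) :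
    IsState (vecMulVec v (star v)) :=
  ⟨posSemidef_vecMulVec_self_star v, by rw [trace_vecMulVec, dotProduct_comm, hv]⟩

/-- The uniform superposition `|ψ_0⟩`. -/
def uniformVec (d : ℕ) : Fin d → ℂ := fun _ => ((Real.sqrt d)⁻¹ : ℝ)

/-- The output of the entrywise conjugate of `X_d ^ a * Z_d ^ b` on `|ψ_0⟩`. -/
def shiftedFourierVec (d : ℕ) [NeZero d] (a b : Fin d) : Fin d → ℂ :=
  (clockShift d a b).map star *ᵥ uniformVec d

lemma inv_sqrt_mul_self (d : ℕ) :
    (((Real.sqrt d)⁻¹ : ℝ) : ℂ) * (((Real.sqrt d)⁻¹ : ℝ) : ℂ) = (d : ℂ)⁻¹ := by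
  rw [← Complex.ofReal_mul, ← mul_inv, Real.mul_self_sqrt (Nat.cast_nonneg d)]
  simp

lemma shiftedFourierVec_apply (d : ℕ) [NeZero d] (a b x : Fin d) :
    shiftedFourierVec d a b x =
      star (omega d ^ (((x - a : Fin d) : ℕ) * (b : ℕ))) * ((Real.sqrt d)⁻¹ : ℝ) := by
  have h (l : Fin d) : x = l + a ↔ l = x - a := by
    rw [eq_sub_iff_add_eq, eq_comm]
  simp [shiftedFourierVec, uniformVec, Matrix.mulVec, dotProduct, clockShift_apply, h,
    apply_ite (starRingEnd ℂ)]

lemma star_uniformVec_dotProduct_self (d : ℕ) [NeZero d] :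
    star (uniformVec d) ⬝ᵥ uniformVec d = 1 := by
  have : (d : ℂ) ≠ 0 := NeZero.ne _
  simp only [uniformVec, dotProduct, Pi.star_apply, Complex.star_def, Complex.conj_ofReal,
    inv_sqrt_mul_self]
  simp [this]

lemma star_shiftedFourierVec_dotProduct_self (d : ℕ) [NeZero d] (a b : Fin d) :
    star (shiftedFourierVec d a b) ⬝ᵥ shiftedFourierVec d a b = 1 := by
  have : (d : ℂ) ≠ 0 := NeZero.ne _
  have h (n : ℕ) : omega d ^ n * star (omega d ^ n) = 1 := by
    rw [star_pow, ← mul_pow, omega_mul_star, one_pow]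
  simp only [dotProduct, Pi.star_apply, shiftedFourierVec_apply, star_mul', star_star,
    mul_mul_mul_comm, h]
  simp only [Complex.star_def, Complex.conj_ofReal, inv_sqrt_mul_self]
  simp [this]

lemma sum_vecMulVec_shiftedFourierVec (d : ℕ) [NeZero d] (a : Fin d) :
    ∑ b, vecMulVec (shiftedFourierVec d a b) (star (shiftedFourierVec d a b)) = 1 := by
  have : (d : ℂ) ≠ 0 := NeZero.ne _
  ext x y
  simp only [Matrix.sum_apply, vecMulVec_apply, Pi.star_apply, shiftedFourierVec_apply, star_mul',
    star_star, mul_mul_mul_comm]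
  simp only [Complex.star_def, Complex.conj_ofReal, inv_sqrt_mul_self]
  simp only [← Complex.star_def]
  rw [← Finset.sum_mul, sum_omega_pow_mul_star, Matrix.one_apply]
  simp only [sub_left_inj]
  split_ifs <;> simp [this]

lemma conj_clockShift_mulVec_single_zero (d : ℕ) [NeZero d] (a b : Fin d) :
    (clockShift d a b).map star *ᵥ Pi.single 0 1 = Pi.single a 1 := by
  ext x
  simp [clockShift_apply, Pi.single_apply, apply_ite (starRingEnd ℂ)]

/-- The `d²` clock-shift unitary channels can be perfectly discriminated with
two uses, no quantum memory and only classical memory: there exist a state `ρ`, a POVM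
`{F^k}`, states `σ^k` and POVMs `{M^{(a,b)|k}}_{(a,b)}` whose associated two-copy classically
adaptive tester achieves success probability `1`. -/
theorem clock_shift_perfect_classical_memory_discrimination (d : ℕ) [NeZero d] :
    ∃ (ρ : Matrix (Fin d) (Fin d) ℂ)
      (F : Fin d → Matrix (Fin d) (Fin d) ℂ)
      (σs : Fin d → Matrix (Fin d) (Fin d) ℂ)
      (M : Fin d → Fin d × Fin d → Matrix (Fin d) (Fin d) ℂ),
      IsState ρ ∧ IsPOVM F ∧ (∀ k, IsState (σs k)) ∧ (∀ k, IsPOVM (M k)) ∧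
      (1 / (d : ℂ) ^ 2) * ∑ ab : Fin d × Fin d,
          Matrix.trace (classMemT ρ F σs M ab *
            choiPair (choiU (clockShift d ab.1 ab.2))) = 1 := by
  have hd : (d : ℂ) ≠ 0 := NeZero.ne _
  let e (k : Fin d) : Fin d → ℂ := Pi.single k 1
  let u := shiftedFourierVec d
  refine ⟨vecMulVec (e 0) (star (e 0)), fun k => vecMulVec (e k) (star (e k)),
    fun _ => vecMulVec (uniformVec d) (star (uniformVec d)),
    fun k ab => if ab.1 = k then vecMulVec (u k ab.2) (star (u k ab.2)) else 0,
    isState_vecMulVec_star (by simp [e]),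
    ⟨fun k => posSemidef_vecMulVec_self_star _, ?_⟩,
    fun _ => isState_vecMulVec_star (star_uniformVec_dotProduct_self d),
    fun k => ⟨fun ab => ?_, ?_⟩, ?_⟩
  · ext x y
    simp [e, Matrix.sum_apply, vecMulVec_apply, Pi.single_apply, Matrix.one_apply]
  · dsimp only
    split_ifs
    · exact posSemidef_vecMulVec_self_star _
    · exact PosSemidef.zero
  · rw [Fintype.sum_prod_type, Finset.sum_comm]
    simpa using sum_vecMulVec_shiftedFourierVec d k
  · have key (ab : Fin d × Fin d) : Matrix.trace (classMemT (vecMulVec (e 0) (star (e 0)))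
        (fun k => vecMulVec (e k) (star (e k)))
        (fun _ => vecMulVec (uniformVec d) (star (uniformVec d)))
        (fun k ab => if ab.1 = k then vecMulVec (u k ab.2) (star (u k ab.2)) else 0) ab *
          choiPair (choiU (clockShift d ab.1 ab.2))) = 1 := by
      rw [trace_classMemT_mul_choiPair, Finset.sum_eq_single ab.1]
      · rw [if_pos rfl, trace_vecMulVec_star_mul, trace_vecMulVec_star_mul]
        simp only [e, conj_clockShift_mulVec_single_zero]
        change _ * (star (u ab.1 ab.2) ⬝ᵥ u ab.1 ab.2 * _) = 1
        change _ * (_ * (star (u ab.1 ab.2) ⬝ᵥ u ab.1 ab.2)) = 1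
        simp [u, star_shiftedFourierVec_dotProduct_self]
      · intro k _ hk
        simp [hk.symm]
      · simp
    simp only [key]
    simp only [Finset.sum_const, Finset.card_univ, Fintype.card_prod, Fintype.card_fin,
      nsmul_eq_mul, Nat.cast_mul]
    field_simp
end
end
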